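/- arXiv:2005.04145 — 4 statements merged into one kernel-verified Lean document; each statement's English description precedes it below -/
import Mathlib

section
/- Let 𝔸 be a liberal finitely bounded homogeneous binary core. Then the disequality relation ≠ on the domain of 𝔸 is pp-definable in 𝔸. -/
set_option autoImplicit false

namespace Wrona

/-- A general relational structure over domain `A`. -/
structure RelStruct (A : Type) : Type 1 where
  ι : Type
  arity : ι → ℕ
  rel : (i : ι) → (Fin (arity i) → A) → Prop

variable {A : Type}

/-- Primitive-positive formulas over a relational structure
    (conjunction, existential quantification and atoms, including equality). -/
inductive PP (S : RelStruct A) : Type where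
  | atom (i : S.ι) (v : Fin (S.arity i) → ℕ) : PP S
  | eq (x y : ℕ) : PP S
  | conj (φ ψ : PP S) : PP S
  | ex (x : ℕ) (φ : PP S) : PP S

def PP.sat {S : RelStruct A} : PP S → (ℕ → A) → Prop
  | .atom i v, f => S.rel i fun k => f (v k)
  | .eq x y, f => f x = f y
  | .conj φ ψ, f => φ.sat f ∧ ψ.sat f
  | .ex x φ, f => ∃ a : A, φ.sat (Function.update f x a)

/-- First-order formulas over a relational structure. -/
inductive FO (S : RelStruct A) : Type where
  | atom (i : S.ι) (v : Fin (S.arity i) → ℕ) : FO S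
  | eq (x y : ℕ) : FO S
  | neg (φ : FO S) : FO S
  | conj (φ ψ : FO S) : FO S
  | ex (x : ℕ) (φ : FO S) : FO S

def FO.sat {S : RelStruct A} : FO S → (ℕ → A) → Prop
  | .atom i v, f => S.rel i fun k => f (v k)
  | .eq x y, f => f x = f y
  | .neg φ, f => ¬ φ.sat f
  | .conj φ ψ, f => φ.sat f ∧ ψ.sat f
  | .ex x φ, f => ∃ a : A, φ.sat (Function.update f x a)

/-- An `n`-ary relation is pp-definable in `S` (variables `0,…,n-1` are the free variables). -/
def PPDef (S : RelStruct A) (n : ℕ) (R : (Fin n → A) → Prop) : Prop :=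
  ∃ φ : PP S, ∀ f : ℕ → A, φ.sat f ↔ R fun i => f i.val

/-- An `n`-ary relation is first-order definable in `S`. -/
def FODef (S : RelStruct A) (n : ℕ) (R : (Fin n → A) → Prop) : Prop :=
  ∃ φ : FO S, ∀ f : ℕ → A, φ.sat f ↔ R fun i => f i.val

/-- A binary relation is pp-definable in `S`. -/
def PPDef2 (S : RelStruct A) (C : A → A → Prop) : Prop :=
  PPDef S 2 fun t => C (t 0) (t 1)

/-- The equality relation. -/
def eqRel (A : Type) : A → A → Prop := fun a b => a = b

/-- A binary core: a structure with (equality and) binary anti-reflexive relations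
`R₁,…,R_κ` such that any two distinct elements are related by exactly one `R_i`. -/
structure BinaryCore (A : Type) (κ : ℕ) : Type where
  rel : Fin κ → A → A → Prop
  antirefl : ∀ i a b, rel i a b → a ≠ b
  total : ∀ a b : A, a ≠ b → ∃ i, rel i a b
  unique : ∀ i j a b, rel i a b → rel j a b → i = j

variable {κ : ℕ}

/-- The binary core viewed as a relational structure. -/
def BinaryCore.toRel (𝔸 : BinaryCore A κ) : RelStruct A :=
  ⟨Fin κ, fun _ => 2, fun i u => 𝔸.rel i (u 0) (u 1)⟩

/-- Automorphisms of a binary core. -/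
def IsAuto (𝔸 : BinaryCore A κ) (g : A ≃ A) : Prop :=
  ∀ i a b, 𝔸.rel i (g a) (g b) ↔ 𝔸.rel i a b

/-- Homogeneity: every isomorphism between finite induced substructures extends
    to an automorphism. -/
def IsHomogeneous (𝔸 : BinaryCore A κ) : Prop :=
  ∀ S : Set A, S.Finite → ∀ f : A → A, Set.InjOn f S →
    (∀ i, ∀ a ∈ S, ∀ b ∈ S, (𝔸.rel i a b ↔ 𝔸.rel i (f a) (f b))) →
    ∃ g : A ≃ A, IsAuto 𝔸 g ∧ ∀ a ∈ S, g a = f a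

/-- `(c,d)` lies in the orbit of `(a,b)` under `Aut(𝔸)`. -/
def SameOrbit (𝔸 : BinaryCore A κ) (a b c d : A) : Prop :=
  ∃ g : A ≃ A, IsAuto 𝔸 g ∧ g a = c ∧ g b = d

/-- An orbital: the orbit of a pair of elements under `Aut(𝔸)`. -/
def IsOrbital (𝔸 : BinaryCore A κ) (O : A → A → Prop) : Prop :=
  ∃ a b : A, ∀ c d : A, O c d ↔ SameOrbit 𝔸 a b c d

/-- Anti-reflexive binary relation. -/
def AntiRefl (C : A → A → Prop) : Prop := ∀ a b, C a b → a ≠ b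

/-- The converse `C⁻¹` of a binary relation. -/
def inv (C : A → A → Prop) : A → A → Prop := fun a b => C b a

/-- A finite structure over the signature of `κ` binary relation symbols. -/
structure FinStruct (κ : ℕ) : Type where
  n : ℕ
  rel : Fin κ → Fin n → Fin n → Prop

/-- Embedding between finite structures. -/
def FSEmbeds (Γ Δ : FinStruct κ) : Prop :=
  ∃ f : Fin Γ.n → Fin Δ.n, Function.Injective f ∧
    ∀ i a b, Γ.rel i a b ↔ Δ.rel i (f a) (f b)

/-- Embedding of a finite structure into a binary core. -/
def EmbedsCore (Γ : FinStruct κ) (𝔸 : BinaryCore A κ) : Prop :=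
  ∃ f : Fin Γ.n → A, Function.Injective f ∧
    ∀ i a b, Γ.rel i a b ↔ 𝔸.rel i (f a) (f b)

/-- `𝔸` is finitely bounded with set of bounds `𝔅`. -/
def FinBoundedBy (𝔸 : BinaryCore A κ) (𝔅 : Set (FinStruct κ)) : Prop :=
  𝔅.Finite ∧ ∀ Δ : FinStruct κ, (EmbedsCore Δ 𝔸 ↔ ∀ Γ ∈ 𝔅, ¬ FSEmbeds Γ Δ)

/-- Liberal: the bounds contain no structures of size 3, 4, 5 or 6. -/
def Liberal (𝔅 : Set (FinStruct κ)) : Prop :=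
  ∀ Γ ∈ 𝔅, Γ.n ≠ 3 ∧ Γ.n ≠ 4 ∧ Γ.n ≠ 5 ∧ Γ.n ≠ 6

/-- `MaxBound`: the maximum of 3 and the size of the largest bound. -/
noncomputable def maxBound (𝔅 : Set (FinStruct κ)) : ℕ :=
  max 3 (sSup (FinStruct.n '' 𝔅))

/-- `𝔹` is a first-order expansion of the binary core `𝔸`. -/
def IsFOExpansion (𝔹 : RelStruct A) (𝔸 : BinaryCore A κ) : Prop :=
  (∀ i : Fin κ, ∃ j : 𝔹.ι, ∃ h : 𝔹.arity j = 2,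
    ∀ u : Fin (𝔹.arity j) → A,
      𝔹.rel j u ↔ 𝔸.rel i (u (Fin.cast h.symm 0)) (u (Fin.cast h.symm 1))) ∧
  ∀ j : 𝔹.ι, FODef 𝔸.toRel (𝔹.arity j) (𝔹.rel j)

/-! CSP instances -/

/-- A constraint over `𝔹` with variables from `V`. -/
structure Constraint (𝔹 : RelStruct A) (V : Type) : Type where
  idx : 𝔹.ι
  scope : Fin (𝔹.arity idx) → V

/-- `t` restricted to `X` belongs to the projection of the constraint `c` to `X`. -/
def Constraint.projOK {𝔹 : RelStruct A} {V : Type} (c : Constraint 𝔹 V)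
    (X : Set V) (t : V → A) : Prop :=
  ∃ u : Fin (𝔹.arity c.idx) → A, 𝔹.rel c.idx u ∧
    ∀ p, c.scope p ∈ X → u p = t (c.scope p)

def IsSolution {𝔹 : RelStruct A} {V : Type} (I : Set (Constraint 𝔹 V)) (s : V → A) : Prop :=
  ∀ c ∈ I, 𝔹.rel c.idx fun p => s (c.scope p)

/-- Non-trivial: no constraint carries the empty relation. -/
def NonTrivial {𝔹 : RelStruct A} {V : Type} (I : Set (Constraint 𝔹 V)) : Prop :=
  ∀ c ∈ I, ∃ u, 𝔹.rel c.idx u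

/-- `(k,l)`-minimality. -/
def IsMinimal {𝔹 : RelStruct A} {V : Type} (I : Set (Constraint 𝔹 V)) (k l : ℕ) : Prop :=
  (∀ X : Set V, X.Finite → X.ncard ≤ l → ∃ c ∈ I, X ⊆ Set.range c.scope) ∧
  ∀ X : Set V, X.Finite → X.ncard ≤ k → ∀ c₁ ∈ I, ∀ c₂ ∈ I,
    X ⊆ Set.range c₁.scope → X ⊆ Set.range c₂.scope →
    ∀ t : V → A, (c₁.projOK X t ↔ c₂.projOK X t)

/-- `𝔹` has relational width `(k,l)`. -/
def HasRelWidth (𝔹 : RelStruct A) (k l : ℕ) : Prop :=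
  ∀ (V : Type), Finite V → ∀ I : Set (Constraint 𝔹 V), I.Finite →
    IsMinimal I k l → ((∃ s, IsSolution I s) ↔ NonTrivial I)

/-- `𝔹` has strict width `k`. -/
def HasStrictWidth (𝔹 : RelStruct A) (k : ℕ) : Prop :=
  ∃ l, k ≤ l ∧ ∀ (V : Type), Finite V → ∀ I : Set (Constraint 𝔹 V), I.Finite →
    IsMinimal I k l → ∀ (W : Set V) (t : V → A),
      (∀ c ∈ I, c.projOK W t) → ∃ s, IsSolution I s ∧ ∀ v ∈ W, s v = t v

def BoundedStrictWidth (𝔹 : RelStruct A) : Prop := ∃ k, HasStrictWidth 𝔹 k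

/-- The structure with domain `A` and a single `n`-ary relation `R`. -/
def singleRel (n : ℕ) (R : (Fin n → A) → Prop) : RelStruct A :=
  ⟨PUnit, fun _ => n, fun _ => R⟩

/-! Projections and entailment -/

/-- The projection of an `n`-ary relation to coordinates `(p,q)`. -/
def proj2 {n : ℕ} (R : (Fin n → A) → Prop) (p q : Fin n) : A → A → Prop :=
  fun a b => ∃ t, R t ∧ t p = a ∧ t q = b

/-- `R` entails no equalities. -/
def EntailsNoEq {n : ℕ} (R : (Fin n → A) → Prop) : Prop :=
  ∀ i j : Fin n, i ≠ j → ∃ t, R t ∧ t i ≠ t j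

/-- `R` efficiently entails `C₁(x_i,x_j) ⟹ D₁(x_k,x_l)`. -/
def EffEntails {n : ℕ} (R : (Fin n → A) → Prop) (i j k l : Fin n)
    (C₁ D₁ : A → A → Prop) : Prop :=
  (∀ t, R t → C₁ (t i) (t j) → D₁ (t k) (t l)) ∧
  (∀ a b, C₁ a b → proj2 R i j a b) ∧ C₁ ≠ proj2 R i j ∧
  (∀ a b, D₁ a b → proj2 R k l a b) ∧ D₁ ≠ proj2 R k l

/-- Critical ternary relation over `(𝔹, C₁, C₂, D₁, D₂)`. -/
def IsCriticalTernary (𝔹 : RelStruct A) (R : (Fin 3 → A) → Prop)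
    (C₁ C₂ D₁ D₂ : A → A → Prop) : Prop :=
  PPDef 𝔹 3 R ∧ PPDef2 𝔹 C₁ ∧ PPDef2 𝔹 C₂ ∧ PPDef2 𝔹 D₁ ∧ PPDef2 𝔹 D₂ ∧
  (∀ a b, ¬ (C₁ a b ∧ C₂ a b)) ∧
  (∀ a b, C₁ a b → proj2 R 0 1 a b) ∧ (∀ a b, C₂ a b → proj2 R 0 1 a b) ∧
  (∀ a b, ¬ (D₁ a b ∧ D₂ a b)) ∧
  (∀ a b, D₁ a b → proj2 R 1 2 a b) ∧ (∀ a b, D₂ a b → proj2 R 1 2 a b) ∧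
  AntiRefl C₁ ∧ AntiRefl D₁ ∧
  ((AntiRefl C₂ ∧ AntiRefl D₂) ∨
    ((∀ a b, C₂ a b ↔ a = b) ∧ (∀ a b, D₂ a b ↔ a = b))) ∧
  (∀ t, R t → C₁ (t 0) (t 1) → D₁ (t 1) (t 2)) ∧
  (∀ t, R t → D₁ (t 1) (t 2) → C₁ (t 0) (t 1)) ∧
  (∀ t, C₁ (t 0) (t 1) → D₁ (t 1) (t 2) → R t) ∧
  (∀ t, C₂ (t 0) (t 1) → D₂ (t 1) (t 2) → R t)

/-! `OP`-tuples and the `⋈`-operations -/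

/-- A ternary `OP`-tuple. -/
def OP3 (O P : A → A → Prop) (t : Fin 3 → A) : Prop := O (t 0) (t 1) ∧ P (t 1) (t 2)

/-- A quaternary `OP`-tuple. -/
def OP4 (O P : A → A → Prop) (t : Fin 4 → A) : Prop := O (t 0) (t 1) ∧ P (t 2) (t 3)

/-- Non-constant tuple. -/
def NonConstant {n : ℕ} (t : Fin n → A) : Prop := ∃ i j, t i ≠ t j

/-- `R₁ ⋈ R₂` for ternary relations. -/
def bowtie3 (R₁ R₂ : (Fin 3 → A) → Prop) : (Fin 3 → A) → Prop :=
  fun t => ∃ y, R₁ ![t 0, t 1, y] ∧ R₂ ![y, t 1, t 2]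

/-- `R₁ ⋈ R₂` for quaternary relations. -/
def bowtie4 (R₁ R₂ : (Fin 4 → A) → Prop) : (Fin 4 → A) → Prop :=
  fun t => ∃ y₁ y₂, R₁ ![t 0, t 1, y₁, y₂] ∧ R₂ ![y₂, y₁, t 2, t 3]

/-- `R₁ ⋈₃ R₂` for quaternary relations. -/
def bowtie43 (R₁ R₂ : (Fin 4 → A) → Prop) : (Fin 3 → A) → Prop :=
  fun t => ∃ y₁ y₂, R₁ ![t 0, t 1, y₁, y₂] ∧ R₂ ![y₂, y₁, t 1, t 2]

/-! Implications -/

inductive Dir : Type where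
  | fwd
  | bwd
  deriving DecidableEq

def lpos3 : Dir → Fin 3 × Fin 3 | .fwd => (0, 1) | .bwd => (1, 0)
def rpos3 : Dir → Fin 3 × Fin 3 | .fwd => (1, 2) | .bwd => (2, 1)
def lpos4 : Dir → Fin 4 × Fin 4 | .fwd => (0, 1) | .bwd => (1, 0)
def rpos4 : Dir → Fin 4 × Fin 4 | .fwd => (2, 3) | .bwd => (3, 2)

/-- Ternary `(𝔹,C,D,C₁,D₁,L,P)`-implications. -/
def IsTerImpl (𝔹 : RelStruct A) (C D C₁ D₁ : A → A → Prop) (L P : Dir)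
    (R : (Fin 3 → A) → Prop) : Prop :=
  EntailsNoEq R ∧ PPDef 𝔹 3 R ∧ PPDef2 𝔹 C₁ ∧ PPDef2 𝔹 D₁ ∧
  proj2 R (lpos3 L).1 (lpos3 L).2 = C ∧
  proj2 R (rpos3 P).1 (rpos3 P).2 = D ∧
  EffEntails R (lpos3 L).1 (lpos3 L).2 (rpos3 P).1 (rpos3 P).2 C₁ D₁

/-- Quaternary `(𝔹,C,D,C₁,D₁,L,P)`-implications. -/
def IsQuatImpl (𝔹 : RelStruct A) (C D C₁ D₁ : A → A → Prop) (L P : Dir)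
    (R : (Fin 4 → A) → Prop) : Prop :=
  EntailsNoEq R ∧ PPDef 𝔹 4 R ∧ PPDef2 𝔹 C₁ ∧ PPDef2 𝔹 D₁ ∧
  proj2 R (lpos4 L).1 (lpos4 L).2 = C ∧
  proj2 R (rpos4 P).1 (rpos4 P).2 = D ∧
  EffEntails R (lpos4 L).1 (lpos4 L).2 (rpos4 P).1 (rpos4 P).2 C₁ D₁

/-- A ternary or quaternary relation. -/
inductive Rel34 (A : Type) : Type where
  | ter : ((Fin 3 → A) → Prop) → Rel34 A
  | quat : ((Fin 4 → A) → Prop) → Rel34 A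

/-- `(𝔹,C,D,C₁,D₁,L,P)`-implications (ternary or quaternary). -/
def IsImpl (𝔹 : RelStruct A) (C D C₁ D₁ : A → A → Prop) (L P : Dir) : Rel34 A → Prop
  | .ter R => IsTerImpl 𝔹 C D C₁ D₁ L P R
  | .quat R => IsQuatImpl 𝔹 C D C₁ D₁ L P R

def Rel34.FODefIn (S : RelStruct A) : Rel34 A → Prop
  | .ter R => FODef S 3 R
  | .quat R => FODef S 4 R

/-- `R` contains an `OP`-tuple. -/
def Rel34.hasOP (O P : A → A → Prop) : Rel34 A → Prop
  | .ter R => ∃ t, R t ∧ O (t 0) (t 1) ∧ P (t 1) (t 2)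
  | .quat R => ∃ t, R t ∧ O (t 0) (t 1) ∧ P (t 2) (t 3)

/-- The composition `R₁ ∘ R₂`; the middle `Bool` argument records whether `P₁ = L₂`. -/
def Rel34.comp : Rel34 A → Bool → Rel34 A → Rel34 A
  | .quat R₁, true, .quat R₂ =>
      .quat fun t => ∃ y₁ y₂, R₁ ![t 0, t 1, y₁, y₂] ∧ R₂ ![y₁, y₂, t 2, t 3]
  | .quat R₁, false, .quat R₂ =>
      .quat fun t => ∃ y₁ y₂, R₁ ![t 0, t 1, y₁, y₂] ∧ R₂ ![y₂, y₁, t 2, t 3]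
  | .quat R₁, true, .ter R₂ =>
      .quat fun t => ∃ y, R₁ ![t 0, t 1, y, t 2] ∧ R₂ ![y, t 2, t 3]
  | .quat R₁, false, .ter R₂ =>
      .quat fun t => ∃ y, R₁ ![t 0, t 1, t 2, y] ∧ R₂ ![y, t 2, t 3]
  | .ter R₁, true, .quat R₂ =>
      .quat fun t => ∃ y, R₁ ![t 0, t 1, y] ∧ R₂ ![t 1, y, t 2, t 3]
  | .ter R₁, false, .quat R₂ =>
      .quat fun t => ∃ y, R₁ ![t 0, t 1, y] ∧ R₂ ![y, t 1, t 2, t 3]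
  | .ter R₁, true, .ter R₂ =>
      .quat fun t => R₁ ![t 0, t 1, t 2] ∧ R₂ ![t 1, t 2, t 3]
  | .ter R₁, false, .ter R₂ =>
      .ter fun t => ∃ y, R₁ ![t 0, t 1, y] ∧ R₂ ![y, t 1, t 2]

/-! The bipartite digraph of a pair of implications -/

/-- Vertices: left copies `O_L` and right copies `O_R` of binary relations. -/
abbrev BVert (A : Type) : Type := (A → A → Prop) ⊕ (A → A → Prop)

/-- `V_L(D)`. -/
def VL (𝔸 : BinaryCore A κ) (D : A → A → Prop) : Set (BVert A) :=
  {v | ∃ O : A → A → Prop, v = Sum.inl O ∧ IsOrbital 𝔸 O ∧ ∀ a b, O a b → D a b}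

/-- `V_R(D)`. -/
def VR (𝔸 : BinaryCore A κ) (D : A → A → Prop) : Set (BVert A) :=
  {v | ∃ O : A → A → Prop, v = Sum.inr O ∧ IsOrbital 𝔸 O ∧ ∀ a b, O a b → D a b}

/-- The vertex set of `B_{R₁,R₂}`: `V_L(C) ∪ V_R(C)`. -/
def VertSet (𝔸 : BinaryCore A κ) (C : A → A → Prop) : Set (BVert A) :=
  VL 𝔸 C ∪ VR 𝔸 C

/-- The arcs of the bipartite digraph `B_{R₁,R₂}`. -/
def BArc (R₁ R₂ : Rel34 A) : BVert A → BVert A → Prop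
  | Sum.inl O, Sum.inr P => R₁.hasOP O (inv P)
  | Sum.inr P, Sum.inl O => R₂.hasOP P (inv O)
  | _, _ => False

/-- The arcs of `B_{R₁,R₂}` restricted to the vertex set `V_L(C) ∪ V_R(C)`. -/
def BArc' (𝔸 : BinaryCore A κ) (C : A → A → Prop) (R₁ R₂ : Rel34 A)
    (v w : BVert A) : Prop :=
  v ∈ VertSet 𝔸 C ∧ w ∈ VertSet 𝔸 C ∧ BArc R₁ R₂ v w

/-- A strongly connected component of the digraph `(Vs, Arc)`. -/
def IsSCC {α : Type} (Arc : α → α → Prop) (Vs : Set α) (S : Set α) : Prop :=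
  S ⊆ Vs ∧ (∀ u ∈ S, ∀ v ∈ S, Relation.ReflTransGen Arc u v) ∧
  ∀ T : Set α, S ⊆ T → T ⊆ Vs →
    (∀ u ∈ T, ∀ v ∈ T, Relation.ReflTransGen Arc u v) → T = S

/-- A set of strongly connected components. -/
def IsSCCSet {α : Type} (Arc : α → α → Prop) (Vs : Set α) (S : Set α) : Prop :=
  ∀ v ∈ S, ∃ T, IsSCC Arc Vs T ∧ v ∈ T ∧ T ⊆ S

/-- A sink: every arc originating in `S` finishes in `S`. -/
def IsSink {α : Type} (Arc : α → α → Prop) (S : Set α) : Prop :=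
  ∀ u ∈ S, ∀ v, Arc u v → v ∈ S

/-- A source: every arc finishing in `S` originates in `S`. -/
def IsSource {α : Type} (Arc : α → α → Prop) (S : Set α) : Prop :=
  ∀ v ∈ S, ∀ u, Arc u v → u ∈ S

/-- A complete `(𝔹,C,C₁,→,←)`-implication. -/
def IsCompleteImpl (𝔸 : BinaryCore A κ) (𝔹 : RelStruct A)
    (C C₁ : A → A → Prop) (R : Rel34 A) : Prop :=
  IsImpl 𝔹 C C C₁ C₁ .fwd .bwd R ∧
  ∀ S : Set (BVert A), IsSCC (BArc' 𝔸 C R R) (VertSet 𝔸 C) S →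
    (∃ D₁ : A → A → Prop, (∀ a b, D₁ a b → C a b) ∧ S = VL 𝔸 D₁ ∪ VR 𝔸 D₁) ∧
    ∀ O P : A → A → Prop, Sum.inl O ∈ S → Sum.inr P ∈ S →
      BArc' 𝔸 C R R (Sum.inl O) (Sum.inr P) ∧ BArc' 𝔸 C R R (Sum.inr P) (Sum.inl O)

/-! The graph of a CSP instance -/

/-- The projection of a constraint to a tuple of variables. -/
def Constraint.projT {𝔹 : RelStruct A} {V : Type} (c : Constraint 𝔹 V)
    {n : ℕ} (xs : Fin n → V) : (Fin n → A) → Prop :=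
  fun t => ∃ u, 𝔹.rel c.idx u ∧ ∀ p q, c.scope p = xs q → u p = t q

/-- `x` occurs in the scope of `c`. -/
def InScope {𝔹 : RelStruct A} {V : Type} (c : Constraint 𝔹 V) (x : V) : Prop :=
  ∃ p, c.scope p = x

/-- `𝓘_{x,y}`: the projection to `(x,y)` of (any) constraint whose scope contains `x,y`. -/
def IProj {𝔹 : RelStruct A} {V : Type} (I : Set (Constraint 𝔹 V)) (x y : V) :
    A → A → Prop :=
  fun a b => ∃ c ∈ I, InScope c x ∧ InScope c y ∧ c.projT ![x, y] ![a, b]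

/-- Vertices `((v₁,v₂),C)` of the graph `G_𝓘`. -/
abbrev GVertT (A V : Type) : Type := (V × V) × (A → A → Prop)

/-- A legitimate vertex of `G_𝓘`: `C` is non-empty, pp-definable in `𝔹` and
`C ⊊ 𝓘_{v₁,v₂}`. -/
def GVert {𝔹 : RelStruct A} {V : Type} (I : Set (Constraint 𝔹 V))
    (v : GVertT A V) : Prop :=
  (∃ a b, v.2 a b) ∧ (∀ a b, v.2 a b → IProj I v.1.1 v.1.2 a b) ∧
  v.2 ≠ IProj I v.1.1 v.1.2 ∧ PPDef2 𝔹 v.2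

/-- The arcs of the graph `G_𝓘`. -/
def GArc {𝔹 : RelStruct A} {V : Type} (I : Set (Constraint 𝔹 V))
    (v w : GVertT A V) : Prop :=
  (w.1.1 = v.1.2 ∧ v.1.1 ≠ v.1.2 ∧ v.1.1 ≠ w.1.2 ∧ v.1.2 ≠ w.1.2 ∧
    ∃ c ∈ I, InScope c v.1.1 ∧ InScope c v.1.2 ∧ InScope c w.1.2 ∧
      ∃ L P : Dir,
        IsTerImpl 𝔹 (IProj I v.1.1 v.1.2) (IProj I v.1.2 w.1.2) v.2 w.2 L P
          (c.projT ![v.1.1, v.1.2, w.1.2])) ∨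
  (v.1.1 ≠ v.1.2 ∧ v.1.1 ≠ w.1.1 ∧ v.1.1 ≠ w.1.2 ∧ v.1.2 ≠ w.1.1 ∧
   v.1.2 ≠ w.1.2 ∧ w.1.1 ≠ w.1.2 ∧
    ∃ c ∈ I, InScope c v.1.1 ∧ InScope c v.1.2 ∧ InScope c w.1.1 ∧ InScope c w.1.2 ∧
      ∃ L P : Dir,
        IsQuatImpl 𝔹 (IProj I v.1.1 v.1.2) (IProj I w.1.1 w.1.2) v.2 w.2 L P
          (c.projT ![v.1.1, v.1.2, w.1.1, w.1.2]))

/-- Arcs of `G_𝓘` between legitimate vertices. -/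
def GArcV {𝔹 : RelStruct A} {V : Type} (I : Set (Constraint 𝔹 V))
    (v w : GVertT A V) : Prop :=
  GVert I v ∧ GVert I w ∧ GArc I v w

/-- The instance entails no equalities. -/
def InstNoEq {𝔹 : RelStruct A} {V : Type} (I : Set (Constraint 𝔹 V)) : Prop :=
  ∀ c ∈ I, ∀ p q : Fin (𝔹.arity c.idx), p ≠ q → ∃ u, 𝔹.rel c.idx u ∧ u p ≠ u q

/-- `𝔹` is implicationally simple: `G_𝓘` is acyclic for every `(2,MaxBound)`-minimal
instance `𝓘` of `CSP(𝔹)` that entails no equalities. -/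
def ImpSimple (𝔹 : RelStruct A) (𝔅 : Set (FinStruct κ)) : Prop :=
  ∀ (V : Type), Finite V → ∀ I : Set (Constraint 𝔹 V), I.Finite →
    IsMinimal I 2 (maxBound 𝔅) → InstNoEq I →
    ∀ v : GVertT A V, ¬ Relation.TransGen (GArcV I) v v

/-- One-point amalgamation of three arbitrary pairs, from liberality. -/
lemma triangle_embeds {A : Type} {κ : ℕ} (𝔸 : BinaryCore A κ) (𝔅 : Set (FinStruct κ))
    (hFB : FinBoundedBy 𝔸 𝔅) (hLib : Liberal 𝔅) (x y a b c d : A)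
    (hxy : x ≠ y) (hab : a ≠ b) (hcd : c ≠ d) :
    ∃ f : Fin 3 → A, Function.Injective f ∧
      (∀ k, 𝔸.rel k x y ↔ 𝔸.rel k (f 0) (f 1)) ∧
      (∀ k, 𝔸.rel k y x ↔ 𝔸.rel k (f 1) (f 0)) ∧
      (∀ k, 𝔸.rel k a b ↔ 𝔸.rel k (f 0) (f 2)) ∧
      (∀ k, 𝔸.rel k c d ↔ 𝔸.rel k (f 1) (f 2)) := by
  let e : Fin 3 → Fin 3 → A := ![![c, c, d], ![a, a, b], ![x, y, x]]
  let Δ : FinStruct κ := ⟨3, fun k u v => u ≠ v ∧ 𝔸.rel k (e (-(u + v)) u) (e (-(u + v)) v)⟩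
  have key : EmbedsCore Δ 𝔸 := by
    rw [hFB.2]
    rintro Γ hΓ ⟨h, hinj, hrel⟩
    have hle : Γ.n ≤ 3 := by simpa using Fintype.card_le_of_injective h hinj
    have hlt : Γ.n < 3 := lt_of_le_of_ne hle (hLib Γ hΓ).1
    have hns : ¬ Function.Surjective h := by
      intro hs
      have : 3 ≤ Γ.n := by simpa using Fintype.card_le_of_surjective h hs
      omega
    rw [Function.Surjective] at hns
    push Not at hns
    obtain ⟨w, hw⟩ := hns
    have third : ∀ u v w : Fin 3, u ≠ w → v ≠ w → u ≠ v → -(u + v) = w := by decide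
    have einj : ∀ u v w : Fin 3, u ≠ w → v ≠ w → u ≠ v → e w u ≠ e w v := by
      intro u v w h1 h2 h3
      fin_cases w <;> fin_cases u <;> fin_cases v <;>
        first
        | exact absurd rfl h1
        | exact absurd rfl h2
        | exact absurd rfl h3
        | exact hxy
        | exact hxy.symm
        | exact hab
        | exact hab.symm
        | exact hcd
        | exact hcd.symm
    refine ((hFB.2 Γ).1 ?_) Γ hΓ ⟨id, Function.injective_id, fun _ _ _ => Iff.rfl⟩
    refine ⟨fun p => e w (h p), ?_, ?_⟩
    · intro p q hpq
      by_contra hne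
      exact einj (h p) (h q) w (hw p) (hw q) (fun hh => hne (hinj hh)) hpq
    · intro k p q
      rw [hrel k p q]
      change (h p ≠ h q ∧ 𝔸.rel k (e (-(h p + h q)) (h p)) (e (-(h p + h q)) (h q))) ↔ _
      by_cases hh : h p = h q
      · constructor
        · intro h1; exact absurd hh h1.1
        · intro h1
          exact absurd (congrArg (e w) hh) (𝔸.antirefl k _ _ h1)
      · rw [third (h p) (h q) w (hw p) (hw q) hh]
        exact ⟨fun h1 => h1.2, fun h1 => ⟨hh, h1⟩⟩
  obtain ⟨f, hf, hr⟩ := key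
  refine ⟨f, hf, fun k => ?_, fun k => ?_, fun k => ?_, fun k => ?_⟩
  · exact Iff.trans ⟨fun h => ⟨by decide, h⟩, fun h => h.2⟩ (hr k (0 : Fin 3) (1 : Fin 3))
  · exact Iff.trans ⟨fun h => ⟨by decide, h⟩, fun h => h.2⟩ (hr k (1 : Fin 3) (0 : Fin 3))
  · exact Iff.trans ⟨fun h => ⟨by decide, h⟩, fun h => h.2⟩ (hr k (0 : Fin 3) (2 : Fin 3))
  · exact Iff.trans ⟨fun h => ⟨by decide, h⟩, fun h => h.2⟩ (hr k (1 : Fin 3) (2 : Fin 3))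

/-- **Observation 2.** Let `𝔸` be a liberal finitely bounded homogeneous binary core.
Then `≠` is pp-definable in `𝔸`. -/
theorem statement2 {A : Type} [Countable A] [Infinite A] {κ : ℕ}
    (𝔸 : BinaryCore A κ) (𝔅 : Set (FinStruct κ))
    (hHom : IsHomogeneous 𝔸) (hFB : FinBoundedBy 𝔸 𝔅) (hLib : Liberal 𝔅) :
    PPDef2 𝔸.toRel (fun a b => a ≠ b) := by
  obtain ⟨a, b, hab⟩ := exists_pair_ne A
  obtain ⟨i, hi⟩ := 𝔸.total a b hab
  by_cases hall : ∀ c d : A, c ≠ d → 𝔸.rel i c d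
  · refine ⟨PP.atom (S := 𝔸.toRel) i (![0, 1] : Fin 2 → ℕ), fun f => ?_⟩
    change 𝔸.rel i (f 0) (f 1) ↔ f 0 ≠ f 1
    exact ⟨𝔸.antirefl i _ _, hall _ _⟩
  · push Not at hall
    obtain ⟨c, d, hcd, hnot⟩ := hall
    obtain ⟨j, hj⟩ := 𝔸.total c d hcd
    have hij : i ≠ j := by
      rintro rfl
      exact hnot hj
    refine ⟨PP.ex 2 (PP.conj (PP.atom (S := 𝔸.toRel) i (![0, 2] : Fin 2 → ℕ))
      (PP.atom (S := 𝔸.toRel) j (![1, 2] : Fin 2 → ℕ))), fun f => ?_⟩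
    change (∃ z : A, 𝔸.rel i (f 0) z ∧ 𝔸.rel j (f 1) z) ↔ f 0 ≠ f 1
    constructor
    · rintro ⟨z, h1, h2⟩ heq
      rw [heq] at h1
      exact hij (𝔸.unique _ _ _ _ h1 h2)
    · intro hne
      obtain ⟨g, hg, h01, h10, h02, h12⟩ :=
        triangle_embeds 𝔸 𝔅 hFB hLib (f 0) (f 1) a b c d hne hab hcd
      have hg01 : g 1 ≠ g 0 := fun h => absurd (hg h) (by decide)
      classical
      let m : A → A := fun t => if t = g 0 then f 0 else f 1
      have m0 : m (g 0) = f 0 := if_pos rfl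
      have m1 : m (g 1) = f 1 := if_neg hg01
      have irr : ∀ k t, ¬ 𝔸.rel k t t := fun k t h => 𝔸.antirefl k t t h rfl
      obtain ⟨σ, hσ, hS⟩ := hHom {g 0, g 1} (by simp) m (by
          rintro s (rfl | rfl) t (rfl | rfl) hst
          · rfl
          · rw [m0, m1] at hst; exact absurd hst hne
          · rw [m0, m1] at hst; exact absurd hst.symm hne
          · rfl) (by
          rintro k s (rfl | rfl) t (rfl | rfl)
          · simp [irr]
          · rw [m0, m1]; exact (h01 k).symm
          · rw [m0, m1]; exact (h10 k).symm
          · simp [irr])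
      have s0 : σ (g 0) = f 0 := (hS _ (by simp)).trans m0
      have s1 : σ (g 1) = f 1 := (hS _ (by simp)).trans m1
      refine ⟨σ (g 2), ?_, ?_⟩
      · rw [← s0]; exact (hσ i _ _).2 ((h02 i).1 hi)
      · rw [← s1]; exact (hσ j _ _).2 ((h12 j).1 hj)

end Wrona
end

section
/- Let R₁, R₂ be two ternary relations first-order definable in a liberal finitely bounded homogeneous binary core 𝔸 such that R₁ contains all injective O₁O₂-tuples and R₂ contains all injective O₂⁻¹O₃-tuples for some anti-reflexive orbitals O₁, O₂, O₃. Then R₁ ⋈ R₂ contains the relation O₁(x₁,x₂) ∧ O₃(x₂,x₃). -/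
set_option autoImplicit false

namespace Wrona

variable {A : Type}

variable {κ : ℕ}

theorem ext_aux {A : Type} {κ : ℕ}
    (𝔸 : BinaryCore A κ) (𝔅 : Set (FinStruct κ))
    (hHom : IsHomogeneous 𝔸) (hFB : FinBoundedBy 𝔸 𝔅) (hLib : Liberal 𝔅)
    (n : ℕ) (hn : n ≤ 5) (s : Fin n → A) (hs : Function.Injective s)
    (p q : A) (hpq : p ≠ q) :
    ∃ y, ∀ k, s k ≠ y ∧ SameOrbit 𝔸 p q (s k) y := by
  classical
  have irr : ∀ i a, ¬ 𝔸.rel i a a := fun i a h => 𝔸.antirefl i a a h rfl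
  let Δ : FinStruct κ := ⟨n + 1, fun i u v =>
    if hu : u.val < n then
      (if hv : v.val < n then 𝔸.rel i (s ⟨u.val, hu⟩) (s ⟨v.val, hv⟩) else 𝔸.rel i p q)
    else (if v.val < n then 𝔸.rel i q p else False)⟩
  have hΔ : EmbedsCore Δ 𝔸 := by
    rw [hFB.2]
    rintro Γ hΓ ⟨f, hf, hfr⟩
    have hcard : Γ.n ≤ n + 1 := by
      have := Fintype.card_le_of_injective f hf
      simpa [Δ] using this
    have hl := hLib Γ hΓ
    have h2 : Γ.n ≤ 2 := by omega
    have hno : ¬ EmbedsCore Γ 𝔸 := fun h =>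
      (hFB.2 Γ).1 h Γ hΓ ⟨id, Function.injective_id, fun _ _ _ => Iff.rfl⟩
    apply hno
    by_cases hj : ∃ j, ¬ (f j).val < n
    · obtain ⟨j, hj⟩ := hj
      have hlt : ∀ k, k ≠ j → (f k).val < n := by
        intro k hk
        by_contra hk'
        apply hk
        apply hf
        apply Fin.ext
        have h3 := (f k).isLt
        have h4 := (f j).isLt
        change _ < n + 1 at h3
        change _ < n + 1 at h4
        omega
      have heq : ∀ u v : Fin Γ.n, u ≠ j → v ≠ j → u = v := by
        intro u v hu hv
        have h3 := u.isLt
        have h4 := v.isLt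
        have h5 := j.isLt
        have hu' : u.val ≠ j.val := fun h => hu (Fin.ext h)
        have hv' : v.val ≠ j.val := fun h => hv (Fin.ext h)
        apply Fin.ext
        omega
      refine ⟨fun k => if k = j then q else p, ?_, ?_⟩
      · intro u v huv
        by_cases hu : u = j <;> by_cases hv : v = j
        · rw [hu, hv]
        · simp [hu, hv] at huv
          exact absurd huv.symm hpq
        · simp [hu, hv] at huv
          exact absurd huv hpq
        · exact heq u v hu hv
      · intro i u v
        rw [hfr]
        by_cases hu : u = j <;> by_cases hv : v = j
        · subst hu; subst hv
          simp [Δ, hj, irr]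
        · subst hu
          simp [Δ, hj, hv, hlt v hv]
        · subst hv
          simp [Δ, hj, hu, hlt u hu]
        · have := heq u v hu hv
          subst this
          simp [Δ, hu, hlt u hu, irr]
    · push Not at hj
      refine ⟨fun k => s ⟨(f k).val, hj k⟩, ?_, ?_⟩
      · intro u v huv
        have := hs huv
        apply hf
        apply Fin.ext
        simpa using this
      · intro i u v
        rw [hfr]
        simp [Δ, hj u, hj v]
  obtain ⟨e, he, her⟩ := hΔ
  change Fin (n + 1) → A at e
  let F : A → A := fun x => if h : ∃ k : Fin n, e k.castSucc = x then s h.choose else x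
  have hF : ∀ k : Fin n, F (e k.castSucc) = s k := by
    intro k
    have h : ∃ k' : Fin n, e k'.castSucc = e k.castSucc := ⟨k, rfl⟩
    have h' : h.choose = k := Fin.castSucc_injective n (he h.choose_spec)
    simp only [F, dif_pos h, h']
  obtain ⟨g, hg, hgF⟩ := hHom (Set.range fun k : Fin n => e k.castSucc) (Set.finite_range _) F
    (by
      rintro _ ⟨u, rfl⟩ _ ⟨v, rfl⟩ h
      simp only [hF] at h
      rw [hs h])
    (by
      rintro i _ ⟨u, rfl⟩ _ ⟨v, rfl⟩
      simp only [hF]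
      rw [← her]
      simp [Δ])
  have hgs : ∀ k : Fin n, g (e k.castSucc) = s k := fun k => by
    rw [hgF _ ⟨k, rfl⟩, hF]
  refine ⟨g (e (Fin.last n)), fun k => ?_⟩
  have hne : s k ≠ g (e (Fin.last n)) := by
    rw [← hgs]
    intro h
    exact (Fin.castSucc_lt_last k).ne (he (g.injective h))
  refine ⟨hne, ?_⟩
  have r1 : ∀ i, 𝔸.rel i p q ↔ 𝔸.rel i (s k) (g (e (Fin.last n))) := by
    intro i
    rw [← hgs, hg, ← her]
    simp [Δ]
  have r2 : ∀ i, 𝔸.rel i q p ↔ 𝔸.rel i (g (e (Fin.last n))) (s k) := by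
    intro i
    rw [← hgs, hg, ← her]
    simp [Δ]
  obtain ⟨g', hg', hh⟩ := hHom {p, q} (Set.toFinite _)
    (fun x => if x = p then s k else g (e (Fin.last n)))
    (by
      rintro x (rfl | rfl) y (rfl | rfl) h
      · rfl
      · simp [hpq.symm] at h
        exact absurd h hne
      · simp [hpq.symm] at h
        exact absurd h.symm hne
      · rfl)
    (by
      rintro i x (rfl | rfl) y (rfl | rfl)
      · simp [irr]
      · simpa [hpq.symm] using r1 i
      · simpa [hpq.symm] using r2 i
      · simp [irr])
  refine ⟨g', hg', ?_, ?_⟩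
  · rw [hh p (by simp)]; simp
  · rw [hh q (by simp)]; simp [hpq.symm]

/-- **Observation 9.** If `R₁` contains all injective `O₁O₂`-tuples and `R₂` all
injective `O₂⁻¹O₃`-tuples for anti-reflexive orbitals `O₁,O₂,O₃`, both ternary
relations fo-definable in a liberal finitely bounded homogeneous binary core `𝔸`,
then `R₁ ⋈ R₂` contains the relation `O₁(x₁,x₂) ∧ O₃(x₂,x₃)`. -/
theorem statement6 {A : Type} [Countable A] [Infinite A] {κ : ℕ}
    (𝔸 : BinaryCore A κ) (𝔅 : Set (FinStruct κ))
    (hHom : IsHomogeneous 𝔸) (hFB : FinBoundedBy 𝔸 𝔅) (hLib : Liberal 𝔅)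
    (O₁ O₂ O₃ : A → A → Prop)
    (hO₁ : IsOrbital 𝔸 O₁) (hO₂ : IsOrbital 𝔸 O₂) (hO₃ : IsOrbital 𝔸 O₃)
    (hA₁ : AntiRefl O₁) (hA₂ : AntiRefl O₂) (hA₃ : AntiRefl O₃)
    (R₁ R₂ : (Fin 3 → A) → Prop)
    (hf₁ : FODef 𝔸.toRel 3 R₁) (hf₂ : FODef 𝔸.toRel 3 R₂)
    (h₁ : ∀ t : Fin 3 → A, Function.Injective t → OP3 O₁ O₂ t → R₁ t)
    (h₂ : ∀ t : Fin 3 → A, Function.Injective t → OP3 (inv O₂) O₃ t → R₂ t) :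
    ∀ a b c : A, O₁ a b → O₃ b c → bowtie3 R₁ R₂ ![a, b, c] := by
  intro a b c hab hbc
  have hne1 := hA₁ a b hab
  have hne3 := hA₃ b c hbc
  obtain ⟨p, q, hO⟩ := hO₂
  have hpq : p ≠ q := hA₂ p q ((hO p q).2 ⟨Equiv.refl A, fun _ _ _ => Iff.rfl, rfl, rfl⟩)
  have key : ∃ y, a ≠ y ∧ b ≠ y ∧ c ≠ y ∧ O₂ b y := by
    by_cases hac : a = c
    · obtain ⟨y, hy⟩ := ext_aux 𝔸 𝔅 hHom hFB hLib 2 (by norm_num) ![a, b]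
        (by
          intro u v h
          fin_cases u <;> fin_cases v <;> simp_all) p q hpq
      have y0 := hy 0
      have y1 := hy 1
      simp only [Matrix.cons_val_zero, Matrix.cons_val_one] at y0 y1
      exact ⟨y, y0.1, y1.1, hac ▸ y0.1, (hO _ _).2 y1.2⟩
    · obtain ⟨y, hy⟩ := ext_aux 𝔸 𝔅 hHom hFB hLib 3 (by norm_num) ![a, b, c]
        (by
          intro u v h
          have := hne1.symm
          have := hne3.symm
          have : c ≠ a := fun h => hac h.symm
          fin_cases u <;> fin_cases v <;> simp_all) p q hpq
      have y0 := hy 0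
      have y1 := hy 1
      have y2 := hy 2
      simp only [Matrix.cons_val_zero, Matrix.cons_val_one, Matrix.cons_val] at y0 y1 y2
      exact ⟨y, y0.1, y1.1, y2.1, (hO _ _).2 y1.2⟩
  obtain ⟨y, ha, hb, hc, hy⟩ := key
  have inj3 : ∀ u v w : A, u ≠ v → u ≠ w → v ≠ w → Function.Injective ![u, v, w] := by
    intro u v w h1 h2 h3 i j h
    have := h1.symm
    have := h2.symm
    have := h3.symm
    fin_cases i <;> fin_cases j <;> simp_all
  refine ⟨y, h₁ _ (inj3 _ _ _ hne1 ha hb) ⟨hab, hy⟩,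
    h₂ _ (inj3 _ _ _ hb.symm hc.symm hne3) ⟨hy, hbc⟩⟩

end Wrona
end

section
/- Let R₁, R₂ be two quaternary relations first-order definable in a liberal finitely bounded homogeneous binary core 𝔸 such that either R₁ contains all injective O₁O₂-tuples and R₂ contains all injective O₂⁻¹O₃-tuples for some anti-reflexive orbitals O₁, O₂, O₃, or O₁, O₂, O₃ all equal the equality relation and both R₁ and R₂ contain all non-constant ==-tuples. Then R₁ ⋈₃ R₂ contains the relation O₁(x₁,x₂) ∧ O₃(x₂,x₃). -/
set_option autoImplicit false

namespace Wrona

variable {A : Type}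

variable {κ : ℕ}

def pr (a b c p q : A) (i j : Fin 5) : A × A :=
  if (i.val < 3 ↔ j.val < 3) then (![a, b, c, p, q] i, ![a, b, c, p, q] j)
  else if i.val < 3 then (p, q) else (q, p)

theorem pr_swap (a b c p q : A) (i j : Fin 5) :
    pr a b c p q j i = ((pr a b c p q i j).2, (pr a b c p q i j).1) := by
  unfold pr
  by_cases h1 : i.val < 3 <;> by_cases h2 : j.val < 3 <;> simp [h1, h2]

theorem pr_diag (a b c p q : A) (i : Fin 5) :
    (pr a b c p q i i).1 = (pr a b c p q i i).2 := by
  simp [pr]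

theorem pr_ne (a b c p q : A) (hab : a ≠ b) (hac : a ≠ c) (hbc : b ≠ c) (hpq : p ≠ q)
    (i j : Fin 5) (hij : i ≠ j) : (pr a b c p q i j).1 ≠ (pr a b c p q i j).2 := by
  fin_cases i <;> fin_cases j <;>
    simp_all [pr, hab.symm, hac.symm, hbc.symm, hpq.symm]

theorem irr (𝔸 : BinaryCore A κ) (k : Fin κ) (x : A) : ¬ 𝔸.rel k x x :=
  fun h => 𝔸.antirefl k x x h rfl

theorem exists_pair [Infinite A] (𝔸 : BinaryCore A κ) (𝔅 : Set (FinStruct κ))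
    (hHom : IsHomogeneous 𝔸) (hFB : FinBoundedBy 𝔸 𝔅) (hLib : Liberal 𝔅)
    (a b c p q : A) (hab : a ≠ b) (hac : a ≠ c) (hbc : b ≠ c) (hpq : p ≠ q) :
    ∃ y₁ y₂ : A, SameOrbit 𝔸 p q y₁ y₂ ∧ y₁ ≠ a ∧ y₁ ≠ b ∧ y₁ ≠ c ∧
      y₂ ≠ a ∧ y₂ ≠ b ∧ y₂ ≠ c ∧ y₁ ≠ y₂ := by
  have hE : EmbedsCore (⟨5, fun k i j => 𝔸.rel k (pr a b c p q i j).1 (pr a b c p q i j).2⟩ :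
      FinStruct κ) 𝔸 := by
    rw [hFB.2]
    rintro ⟨n, r⟩ hΓ ⟨f, hf, hr⟩
    have hL := hLib _ hΓ
    have hn : n ≤ 5 := by simpa using Fintype.card_le_of_injective f hf
    have hno : ¬ EmbedsCore (⟨n, r⟩ : FinStruct κ) 𝔸 := by
      intro h
      exact (hFB.2 _).1 h _ hΓ ⟨id, Function.injective_id, fun _ _ _ => Iff.rfl⟩
    apply hno
    dsimp only at hL f hf hr
    have hn2 : n = 0 ∨ n = 1 ∨ n = 2 := by omega
    rcases hn2 with rfl | rfl | rfl
    · exact ⟨fun _ => a, fun x => x.elim0, fun _ x => x.elim0⟩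
    · refine ⟨fun _ => a, fun x y _ => Subsingleton.elim _ _, fun k x y => ?_⟩
      obtain rfl : x = y := Subsingleton.elim _ _
      dsimp only
      rw [hr, pr_diag]
      exact iff_of_false (irr _ _ _) (irr _ _ _)
    · have h01 : f 0 ≠ f 1 := fun h => by simpa using hf h
      have hne := pr_ne a b c p q hab hac hbc hpq _ _ h01
      refine ⟨![(pr a b c p q (f 0) (f 1)).1, (pr a b c p q (f 0) (f 1)).2], ?_, ?_⟩
      · intro x y hxy
        fin_cases x <;> fin_cases y <;> simp_all
      · intro k x y
        dsimp only
        rw [hr]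
        fin_cases x <;> fin_cases y
        · dsimp
          rw [pr_diag]
          exact iff_of_false (irr _ _ _) (irr _ _ _)
        · simp
        · dsimp
          rw [pr_swap a b c p q (f 0) (f 1)]
        · dsimp
          rw [pr_diag]
          exact iff_of_false (irr _ _ _) (irr _ _ _)
  obtain ⟨f, hf, hr⟩ := hE
  dsimp only at f hf hr
  have hfab : f 0 ≠ f 1 := fun h => by simpa using hf h
  have hfac : f 0 ≠ f 2 := fun h => by simpa using hf h
  have hfbc : f 1 ≠ f 2 := fun h => by simpa using hf h
  classical
  obtain ⟨g, hg, hgS⟩ := hHom {a, b, c} (by simp)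
    (fun x => if x = a then f 0 else if x = b then f 1 else f 2)
    (by
      intro x hx y hy h
      rcases hx with rfl | rfl | rfl <;> rcases hy with rfl | rfl | rfl <;>
        simp_all [Ne.symm])
    (by
      intro k x hx y hy
      have h00 := hr k 0 0
      have h01 := hr k 0 1
      have h02 := hr k 0 2
      have h10 := hr k 1 0
      have h11 := hr k 1 1
      have h12 := hr k 1 2
      have h20 := hr k 2 0
      have h21 := hr k 2 1
      have h22 := hr k 2 2
      simp [pr] at h00 h01 h02 h10 h11 h12 h20 h21 h22
      rcases hx with rfl | rfl | rfl <;> rcases hy with rfl | rfl | rfl <;>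
        simp_all [Ne.symm])
  have ga : g a = f 0 := by simpa using hgS a (by simp)
  have gb : g b = f 1 := by simpa [hab.symm] using hgS b (by simp)
  have gc : g c = f 2 := by simpa [hac.symm, hbc.symm] using hgS c (by simp)
  have key : ∀ i j : Fin 5, i ≠ j → g.symm (f i) ≠ g.symm (f j) :=
    fun i j hij h => hij (hf (g.symm.injective h))
  have sa : a = g.symm (f 0) := by rw [← ga]; simp
  have sb : b = g.symm (f 1) := by rw [← gb]; simp
  have sc : c = g.symm (f 2) := by rw [← gc]; simp
  refine ⟨g.symm (f 3), g.symm (f 4), ?_, ?_⟩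
  · have hgs : ∀ k x y, 𝔸.rel k (g.symm x) (g.symm y) ↔ 𝔸.rel k x y := by
      intro k x y
      have := hg k (g.symm x) (g.symm y)
      simpa using this.symm
    have h34 : f 3 ≠ f 4 := fun h => by simpa using hf h
    obtain ⟨g', hg', hS'⟩ := hHom {p, q} (by simp)
      (fun x => if x = p then g.symm (f 3) else g.symm (f 4))
      (by
        intro x hx y hy h
        rcases hx with rfl | rfl <;> rcases hy with rfl | rfl <;>
          simp_all [Ne.symm])
      (by
        intro k x hx y hy
        have h33 := hr k 3 3
        have h34 := hr k 3 4
        have h43 := hr k 4 3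
        have h44 := hr k 4 4
        simp [pr] at h33 h34 h43 h44
        rcases hx with rfl | rfl <;> rcases hy with rfl | rfl <;>
          simp_all [Ne.symm])
    exact ⟨g', hg', by simpa using hS' p (by simp), by simpa [hpq.symm] using hS' q (by simp)⟩
  · rw [sa, sb, sc]
    refine ⟨?_, ?_, ?_, ?_, ?_, ?_, ?_⟩ <;> exact key _ _ (by decide)

theorem inj4 (a b c d : A) (h1 : a ≠ b) (h2 : a ≠ c) (h3 : a ≠ d) (h4 : b ≠ c) (h5 : b ≠ d)
    (h6 : c ≠ d) : Function.Injective ![a, b, c, d] := by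
  intro x y hxy
  fin_cases x <;> fin_cases y <;> simp_all

/-- **Observation 10.** For quaternary `R₁, R₂` fo-definable in a liberal finitely
bounded homogeneous binary core `𝔸`: if `R₁` contains all injective `O₁O₂`-tuples
and `R₂` all injective `O₂⁻¹O₃`-tuples for anti-reflexive orbitals `O₁,O₂,O₃`,
or `O₁,O₂,O₃` are `=` and both contain all non-constant `==`-tuples, then
`R₁ ⋈₃ R₂` contains the relation `O₁(x₁,x₂) ∧ O₃(x₂,x₃)`. -/
theorem statement7 {A : Type} [Countable A] [Infinite A] {κ : ℕ}
    (𝔸 : BinaryCore A κ) (𝔅 : Set (FinStruct κ))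
    (hHom : IsHomogeneous 𝔸) (hFB : FinBoundedBy 𝔸 𝔅) (hLib : Liberal 𝔅)
    (O₁ O₂ O₃ : A → A → Prop)
    (hO₁ : IsOrbital 𝔸 O₁) (hO₂ : IsOrbital 𝔸 O₂) (hO₃ : IsOrbital 𝔸 O₃)
    (R₁ R₂ : (Fin 4 → A) → Prop)
    (hf₁ : FODef 𝔸.toRel 4 R₁) (hf₂ : FODef 𝔸.toRel 4 R₂)
    (hcase :
      ((AntiRefl O₁ ∧ AntiRefl O₂ ∧ AntiRefl O₃) ∧
        (∀ t : Fin 4 → A, Function.Injective t → OP4 O₁ O₂ t → R₁ t) ∧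
        (∀ t : Fin 4 → A, Function.Injective t → OP4 (inv O₂) O₃ t → R₂ t)) ∨
      ((O₁ = eqRel A ∧ O₂ = eqRel A ∧ O₃ = eqRel A) ∧
        (∀ t : Fin 4 → A, NonConstant t → OP4 (eqRel A) (eqRel A) t → R₁ t) ∧
        (∀ t : Fin 4 → A, NonConstant t → OP4 (eqRel A) (eqRel A) t → R₂ t))) :
    ∀ a b c : A, O₁ a b → O₃ b c → bowtie43 R₁ R₂ ![a, b, c] := by
  rcases hcase with ⟨⟨ha1, ha2, ha3⟩, h1, h2⟩ | ⟨⟨rfl, rfl, rfl⟩, h1, h2⟩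
  · intro a b c hab hbc
    obtain ⟨p, q, hO⟩ := hO₂
    have hpq : p ≠ q := ha2 p q ((hO p q).2 ⟨Equiv.refl A, fun _ _ _ => Iff.rfl, rfl, rfl⟩)
    have nab := ha1 a b hab
    have nbc := ha3 b c hbc
    have : ∃ y₁ y₂ : A, SameOrbit 𝔸 p q y₁ y₂ ∧ y₁ ≠ a ∧ y₁ ≠ b ∧ y₁ ≠ c ∧
        y₂ ≠ a ∧ y₂ ≠ b ∧ y₂ ≠ c ∧ y₁ ≠ y₂ := by
      by_cases hac : a = c
      · subst hac
        obtain ⟨d, hd⟩ := Infinite.exists_notMem_finset ({a, b} : Set A).toFinite.toFinset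
        simp at hd
        obtain ⟨y₁, y₂, h⟩ := exists_pair 𝔸 𝔅 hHom hFB hLib a b d p q nab
          (fun h => hd.1 h.symm) (fun h => hd.2 h.symm) hpq
        exact ⟨y₁, y₂, by tauto⟩
      · exact exists_pair 𝔸 𝔅 hHom hFB hLib a b c p q nab hac nbc hpq
    obtain ⟨y₁, y₂, hS, e1, e2, e3, e4, e5, e6, e7⟩ := this
    have hy : O₂ y₁ y₂ := (hO _ _).2 hS
    refine ⟨y₁, y₂, h1 _ ?_ ⟨hab, hy⟩, h2 _ ?_ ⟨hy, hbc⟩⟩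
    · exact inj4 _ _ _ _ nab e1.symm e4.symm e2.symm e5.symm e7
    · exact inj4 _ _ _ _ e7.symm e5 e6 e2 e3 nbc
  · intro a b c hab hbc
    obtain rfl : a = b := hab
    obtain rfl : a = c := hbc
    obtain ⟨d, hd⟩ := exists_ne a
    exact ⟨d, d, h1 _ ⟨0, 2, hd.symm⟩ ⟨rfl, rfl⟩, h2 _ ⟨0, 2, hd⟩ ⟨rfl, rfl⟩⟩

end Wrona
end

section
/- Let R₁, R₂ be (𝔹,C,C₁,→,←)-implications, where 𝔹 is a first-order expansion of a liberal finitely bounded homogeneous binary core 𝔸. Then V_L(C₁) ∪ V_R(C₁) is a set of strongly connected components of the bipartite digraph B_{R₁,R₂} which is a sink; moreover, there exist non-empty D₁, F₁ ⊆ C ∖ C₁ such that V_L(D₁) ∪ V_R(F₁) is a source in B_{R₁,R₂}. -/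
set_option autoImplicit false

namespace Wrona

variable {A : Type}

variable {κ : ℕ}

theorem FO_inv {A : Type} {κ : ℕ} (𝔸 : BinaryCore A κ) (g : A ≃ A) (hg : IsAuto 𝔸 g)
    (φ : FO 𝔸.toRel) : ∀ f : ℕ → A, φ.sat (fun n => g (f n)) ↔ φ.sat f := by
  induction φ with
  | atom i v => intro f; exact hg i _ _
  | eq x y => intro f; exact g.injective.eq_iff
  | neg φ ih => intro f; exact not_congr (ih f)
  | conj φ ψ ih1 ih2 => intro f; exact and_congr (ih1 f) (ih2 f)
  | ex x φ ih =>
    intro f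
    have key : ∀ a, Function.update (fun n => g (f n)) x (g a)
        = fun n => g (Function.update f x a n) := by
      intro a; funext n
      by_cases h : n = x
      · subst h; simp
      · simp [h]
    constructor
    · rintro ⟨a, ha⟩
      refine ⟨g.symm a, (ih _).1 ?_⟩
      rw [← key]; simpa using ha
    · rintro ⟨a, ha⟩
      refine ⟨g a, ?_⟩
      rw [key]; exact (ih _).2 ha

theorem extend_fin {A : Type} (a : A) {n : ℕ} (u : Fin n → A) :
    ∃ f : ℕ → A, (fun i : Fin n => f i.val) = u :=
  ⟨fun k => if h : k < n then u ⟨k, h⟩ else a, by funext i; simp⟩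

theorem FODef_inv {A : Type} {κ : ℕ} (𝔸 : BinaryCore A κ) (g : A ≃ A) (hg : IsAuto 𝔸 g)
    (a : A) {n : ℕ} (R : (Fin n → A) → Prop) (hR : FODef 𝔸.toRel n R) (u : Fin n → A) :
    R (fun i => g (u i)) ↔ R u := by
  obtain ⟨φ, hφ⟩ := hR
  obtain ⟨f, rfl⟩ := extend_fin a u
  rw [← hφ f, ← FO_inv 𝔸 g hg φ f, hφ]

theorem PP_inv {A : Type} {κ : ℕ} (𝔸 : BinaryCore A κ) (𝔹 : RelStruct A)
    (hExp : IsFOExpansion 𝔹 𝔸) (g : A ≃ A) (hg : IsAuto 𝔸 g)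
    (φ : PP 𝔹) : ∀ f : ℕ → A, φ.sat (fun n => g (f n)) ↔ φ.sat f := by
  induction φ with
  | atom i v => intro f; exact FODef_inv 𝔸 g hg (f 0) _ (hExp.2 i) _
  | eq x y => intro f; exact g.injective.eq_iff
  | conj φ ψ ih1 ih2 => intro f; exact and_congr (ih1 f) (ih2 f)
  | ex x φ ih =>
    intro f
    have key : ∀ a, Function.update (fun n => g (f n)) x (g a)
        = fun n => g (Function.update f x a n) := by
      intro a; funext n
      by_cases h : n = x
      · subst h; simp
      · simp [h]
    constructor
    · rintro ⟨a, ha⟩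
      refine ⟨g.symm a, (ih _).1 ?_⟩
      rw [← key]; simpa using ha
    · rintro ⟨a, ha⟩
      refine ⟨g a, ?_⟩
      rw [key]; exact (ih _).2 ha

theorem PPDef2_inv {A : Type} {κ : ℕ} (𝔸 : BinaryCore A κ) (𝔹 : RelStruct A)
    (hExp : IsFOExpansion 𝔹 𝔸) (g : A ≃ A) (hg : IsAuto 𝔸 g)
    (C : A → A → Prop) (hC : PPDef2 𝔹 C) (a b : A) : C (g a) (g b) ↔ C a b := by
  obtain ⟨φ, hφ⟩ := hC
  have h1 := hφ (fun n => if n = 0 then a else b)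
  have h2 := hφ (fun n => g (if n = 0 then a else b))
  rw [PP_inv 𝔸 𝔹 hExp g hg φ (fun n => if n = 0 then a else b), h1] at h2
  simpa using h2.symm

theorem orb_dichotomy {A : Type} {κ : ℕ} (𝔸 : BinaryCore A κ) (𝔹 : RelStruct A)
    (hExp : IsFOExpansion 𝔹 𝔸) (C : A → A → Prop) (hC : PPDef2 𝔹 C)
    (O : A → A → Prop) (hO : IsOrbital 𝔸 O) (x y : A) (hxy : O x y) (hc : C x y) :
    ∀ a b, O a b → C a b := by
  obtain ⟨a, b, h⟩ := hO
  obtain ⟨g, hg, rfl, rfl⟩ := (h _ _).1 hxy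
  rw [PPDef2_inv 𝔸 𝔹 hExp g hg C hC] at hc
  intro c d hcd
  obtain ⟨k, hk, rfl, rfl⟩ := (h _ _).1 hcd
  rwa [PPDef2_inv 𝔸 𝔹 hExp k hk C hC]

theorem orb_nonempty {A : Type} {κ : ℕ} (𝔸 : BinaryCore A κ)
    (O : A → A → Prop) (hO : IsOrbital 𝔸 O) : ∃ a b, O a b := by
  obtain ⟨a, b, h⟩ := hO
  exact ⟨a, b, (h a b).2 ⟨Equiv.refl A, fun _ _ _ => Iff.rfl, rfl, rfl⟩⟩

theorem impl_facts {A : Type} (𝔹 : RelStruct A) (C C₁ : A → A → Prop) (R : Rel34 A)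
    (h : IsImpl 𝔹 C C C₁ C₁ .fwd .bwd R) :
    PPDef2 𝔹 C₁ ∧ (∀ a b, C₁ a b → C a b) ∧ C₁ ≠ C ∧
    ∀ O P : A → A → Prop, R.hasOP O (inv P) → (∀ a b, O a b → C₁ a b) →
      ∃ x y, P x y ∧ C₁ x y := by
  cases R with
  | ter R =>
    obtain ⟨-, -, h1, -, h2, -, h3, h4, h5, -, -⟩ := h
    rw [h2] at h4 h5
    refine ⟨h1, h4, h5, ?_⟩
    rintro O P ⟨t, ht, hO, hP⟩ hOC
    exact ⟨t 2, t 1, hP, h3 t ht (hOC _ _ hO)⟩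
  | quat R =>
    obtain ⟨-, -, h1, -, h2, -, h3, h4, h5, -, -⟩ := h
    rw [h2] at h4 h5
    refine ⟨h1, h4, h5, ?_⟩
    rintro O P ⟨t, ht, hO, hP⟩ hOC
    exact ⟨t 3, t 2, hP, h3 t ht (hOC _ _ hO)⟩

/-- **Lemma 18.** Let `R₁, R₂` be `(𝔹,C,C₁,→,←)`-implications, `𝔹` a first-order
expansion of a liberal finitely bounded homogeneous binary core `𝔸`. Then
`V_L(C₁) ∪ V_R(C₁)` is a set of strongly connected components of `B_{R₁,R₂}` which is
a sink; moreover there are non-empty `D₁, F₁ ⊆ C ∖ C₁` such that `V_L(D₁) ∪ V_R(F₁)`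
is a source in `B_{R₁,R₂}`. -/
theorem statement15 {A : Type} [Countable A] [Infinite A] {κ : ℕ}
    (𝔸 : BinaryCore A κ) (𝔅 : Set (FinStruct κ)) (𝔹 : RelStruct A)
    (hHom : IsHomogeneous 𝔸) (hFB : FinBoundedBy 𝔸 𝔅) (hLib : Liberal 𝔅)
    (hExp : IsFOExpansion 𝔹 𝔸)
    (C C₁ : A → A → Prop) (R₁ R₂ : Rel34 A)
    (h₁ : IsImpl 𝔹 C C C₁ C₁ .fwd .bwd R₁)
    (h₂ : IsImpl 𝔹 C C C₁ C₁ .fwd .bwd R₂) :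
    IsSCCSet (BArc' 𝔸 C R₁ R₂) (VertSet 𝔸 C) (VL 𝔸 C₁ ∪ VR 𝔸 C₁) ∧
    IsSink (BArc' 𝔸 C R₁ R₂) (VL 𝔸 C₁ ∪ VR 𝔸 C₁) ∧
    ∃ D₁ F₁ : A → A → Prop,
      (∃ a b, D₁ a b) ∧ (∃ a b, F₁ a b) ∧
      (∀ a b, D₁ a b → C a b ∧ ¬ C₁ a b) ∧
      (∀ a b, F₁ a b → C a b ∧ ¬ C₁ a b) ∧
      IsSource (BArc' 𝔸 C R₁ R₂) (VL 𝔸 D₁ ∪ VR 𝔸 F₁) := by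
  obtain ⟨hpp, hsub, hne, hop₁⟩ := impl_facts 𝔹 C C₁ R₁ h₁
  obtain ⟨-, -, -, hop₂⟩ := impl_facts 𝔹 C C₁ R₂ h₂
  have hdich := orb_dichotomy 𝔸 𝔹 hExp C₁ hpp
  have hS : VL 𝔸 C₁ ∪ VR 𝔸 C₁ ⊆ VertSet 𝔸 C := by
    rintro v (⟨O, rfl, hO, hs⟩ | ⟨O, rfl, hO, hs⟩)
    · exact Or.inl ⟨O, rfl, hO, fun a b h => hsub _ _ (hs a b h)⟩
    · exact Or.inr ⟨O, rfl, hO, fun a b h => hsub _ _ (hs a b h)⟩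
  have hsink : IsSink (BArc' 𝔸 C R₁ R₂) (VL 𝔸 C₁ ∪ VR 𝔸 C₁) := by
    rintro u (⟨O, rfl, hO, hs⟩ | ⟨O, rfl, hO, hs⟩) v ⟨-, hv, harc⟩
    · rcases hv with ⟨P, rfl, hP, -⟩ | ⟨P, rfl, hP, -⟩
      · exact harc.elim
      · obtain ⟨x, y, hxy, hc⟩ := hop₁ O P harc hs
        exact Or.inr ⟨P, rfl, hP, hdich P hP x y hxy hc⟩
    · rcases hv with ⟨P, rfl, hP, -⟩ | ⟨P, rfl, hP, -⟩
      · obtain ⟨x, y, hxy, hc⟩ := hop₂ O P harc hs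
        exact Or.inl ⟨P, rfl, hP, hdich P hP x y hxy hc⟩
      · exact harc.elim
  have hcompl : ∀ v ∈ VertSet 𝔸 C, v ∉ VL 𝔸 C₁ ∪ VR 𝔸 C₁ →
      v ∈ VL 𝔸 (fun a b => C a b ∧ ¬ C₁ a b) ∪ VR 𝔸 (fun a b => C a b ∧ ¬ C₁ a b) := by
    rintro v (⟨O, rfl, hO, hs⟩ | ⟨O, rfl, hO, hs⟩) hn
    · exact Or.inl ⟨O, rfl, hO, fun a b h => ⟨hs a b h, fun hc =>
        hn (Or.inl ⟨O, rfl, hO, hdich O hO a b h hc⟩)⟩⟩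
    · exact Or.inr ⟨O, rfl, hO, fun a b h => ⟨hs a b h, fun hc =>
        hn (Or.inr ⟨O, rfl, hO, hdich O hO a b h hc⟩)⟩⟩
  have hdisj : ∀ v ∈ VL 𝔸 (fun a b => C a b ∧ ¬ C₁ a b) ∪ VR 𝔸 (fun a b => C a b ∧ ¬ C₁ a b),
      v ∉ VL 𝔸 C₁ ∪ VR 𝔸 C₁ := by
    rintro v (⟨O, rfl, hO, hs⟩ | ⟨O, rfl, hO, hs⟩) (⟨P, hP, -, hs'⟩ | ⟨P, hP, -, hs'⟩)
    · cases hP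
      obtain ⟨a, b, h⟩ := orb_nonempty 𝔸 O hO
      exact (hs a b h).2 (hs' a b h)
    · cases hP
    · cases hP
    · cases hP
      obtain ⟨a, b, h⟩ := orb_nonempty 𝔸 O hO
      exact (hs a b h).2 (hs' a b h)
  have hreach : ∀ v ∈ VL 𝔸 C₁ ∪ VR 𝔸 C₁, ∀ u,
      Relation.ReflTransGen (BArc' 𝔸 C R₁ R₂) v u → u ∈ VL 𝔸 C₁ ∪ VR 𝔸 C₁ := by
    intro v hv u hu
    induction hu with
    | refl => exact hv
    | tail _ h ih => exact hsink _ ih _ h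
  have hex : ∃ a b, C a b ∧ ¬ C₁ a b := by
    by_contra hcon
    push Not at hcon
    exact hne (funext fun a => funext fun b => propext ⟨hsub a b, hcon a b⟩)
  refine ⟨?_, hsink, _, _, hex, hex, fun _ _ h => h, fun _ _ h => h, ?_⟩
  · intro v hv
    refine ⟨{u | Relation.ReflTransGen (BArc' 𝔸 C R₁ R₂) v u ∧
      Relation.ReflTransGen (BArc' 𝔸 C R₁ R₂) u v}, ⟨?_, ?_, ?_⟩, ⟨.refl, .refl⟩, ?_⟩
    · rintro u ⟨hu, -⟩
      exact hS (hreach v hv u hu)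
    · rintro u ⟨-, hu⟩ w ⟨hw, -⟩
      exact hu.trans hw
    · intro T hT hTV hTc
      refine Set.Subset.antisymm ?_ hT
      intro u hu
      have hvT : v ∈ T := hT ⟨.refl, .refl⟩
      exact ⟨hTc v hvT u hu, hTc u hu v hvT⟩
    · rintro u ⟨hu, -⟩
      exact hreach v hv u hu
  · intro v hv u hu
    exact hcompl u hu.1 fun hus => hdisj v hv (hsink u hus v hu)

end Wrona
end
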